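/- Let T = (A − i)(A + i)^{-1} be the Cayley transform of A, a contraction on H, and let D_T = √(I − T*T) and D_{T*} = √(I − TT*) (positive square roots). For λ ∈ ℂ with |λ| < 1, let Θ(λ) : closure(Ran D_T) → closure(Ran D_{T*}) be the Sz.-Nagy–Foias characteristic function, defined as the restriction of −T + λ D_{T*}(I − λT*)^{-1}D_T to closure(Ran D_T). Then there exist surjective isometries U : E → closure(Ran D_T) and U_* : E_* → closure(Ran D_{T*}) such that for every z ∈ ℂ with Im z > 0 and λ = (z − i)/(z + i), one has Θ(λ) = U_* S(z) U*. -/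

import Mathlib

open scoped ComplexInnerProductSpace

noncomputable section

/-- A maximal dissipative operator on a complex Hilbert space `H`, together with the
(derivable) data of its resolvent on the open lower half-plane and the resolvent of its
adjoint on the open upper half-plane.  Here the inner product `⟪·,·⟫` is conjugate-linear
in the first variable, so that the paper's `⟨x, y⟩` corresponds to `⟪y, x⟫`. -/
structure MDO (H : Type*) [NormedAddCommGroup H] [InnerProductSpace ℂ H]
    [CompleteSpace H] where
  /-- The underlying densely defined operator. -/
  A : H →ₗ.[ℂ] H
  dense_dom : Dense (A.domain : Set H)
  dissipative : ∀ u : A.domain, 0 ≤ (⟪(u : H), A u⟫).im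
  /-- `R z` is the bounded inverse `(A - z)⁻¹`, for `Im z < 0`. -/
  R : ℂ → H →L[ℂ] H
  R_mem : ∀ z, z.im < 0 → ∀ h : H, R z h ∈ A.domain
  R_right : ∀ z (hz : z.im < 0) (h : H), A ⟨R z h, R_mem z hz h⟩ - z • R z h = h
  R_left : ∀ z, z.im < 0 → ∀ u : A.domain, R z (A u - z • (u : H)) = (u : H)
  dense_dom_star : Dense (A.adjoint.domain : Set H)
  anti_dissipative_star : ∀ u : A.adjoint.domain, (⟪(u : H), A.adjoint u⟫).im ≤ 0
  /-- `Rs z` is the bounded inverse `(A* - z)⁻¹`, for `Im z > 0`. -/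
  Rs : ℂ → H →L[ℂ] H
  Rs_mem : ∀ z, 0 < z.im → ∀ h : H, Rs z h ∈ A.adjoint.domain
  Rs_right : ∀ z (hz : 0 < z.im) (h : H),
    A.adjoint ⟨Rs z h, Rs_mem z hz h⟩ - z • Rs z h = h
  Rs_left : ∀ z, 0 < z.im → ∀ u : A.adjoint.domain,
    Rs z (A.adjoint u - z • (u : H)) = (u : H)

/-- A maximal dissipative operator together with boundary operators `Γ`, `Γ_*` satisfying
the abstract Lagrange identities, and the bounded compositions `ΓR z = Γ ∘ (A - z)⁻¹`
(for `Im z < 0`) and `ΓsRs z = Γ_* ∘ (A* - z)⁻¹` (for `Im z > 0`). -/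
structure StrausSetting (H E Es : Type*)
    [NormedAddCommGroup H] [InnerProductSpace ℂ H] [CompleteSpace H]
    [NormedAddCommGroup E] [InnerProductSpace ℂ E] [CompleteSpace E]
    [NormedAddCommGroup Es] [InnerProductSpace ℂ Es] [CompleteSpace Es]
    extends MDO H where
  Γ : A.domain →ₗ[ℂ] E
  Γ_bdd : ∃ C : ℝ, ∀ u : A.domain, ‖Γ u‖ ≤ C * (‖(u : H)‖ + ‖A u‖)
  Γ_dense : DenseRange Γ
  lagrange : ∀ u v : A.domain,
    ⟪(v : H), A u⟫ - ⟪A v, (u : H)⟫ = Complex.I * ⟪Γ v, Γ u⟫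
  Γs : A.adjoint.domain →ₗ[ℂ] Es
  Γs_bdd : ∃ C : ℝ, ∀ u : A.adjoint.domain,
    ‖Γs u‖ ≤ C * (‖(u : H)‖ + ‖A.adjoint u‖)
  Γs_dense : DenseRange Γs
  lagrange_star : ∀ u v : A.adjoint.domain,
    ⟪(v : H), A.adjoint u⟫ - ⟪A.adjoint v, (u : H)⟫ = -Complex.I * ⟪Γs v, Γs u⟫
  /-- `ΓR z = Γ ∘ (A - z)⁻¹` as a bounded operator `H →L[ℂ] E`, for `Im z < 0`. -/
  ΓR : ℂ → H →L[ℂ] E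
  ΓR_spec : ∀ z (hz : z.im < 0) (h : H), ΓR z h = Γ ⟨R z h, R_mem z hz h⟩
  /-- `ΓsRs z = Γ_* ∘ (A* - z)⁻¹` as a bounded operator `H →L[ℂ] Es`, for `Im z > 0`. -/
  ΓsRs : ℂ → H →L[ℂ] Es
  ΓsRs_spec : ∀ z (hz : 0 < z.im) (h : H), ΓsRs z h = Γs ⟨Rs z h, Rs_mem z hz h⟩

theorem aux_intertwine {B : Type*} [CStarAlgebra B] [PartialOrder B] [StarOrderedRing B]
    {a b t : B} (ha : 0 ≤ a) (hb : 0 ≤ b) (h : t * (a * a) = (b * b) * t) :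
    t * a = b * t := by
  have hsa : star a = a := (IsSelfAdjoint.of_nonneg ha).star_eq
  have hsb : star b = b := (IsSelfAdjoint.of_nonneg hb).star_eq
  obtain ⟨X, hX⟩ : ∃ X, X = t * a - b * t := ⟨_, rfl⟩
  have hbX : b * X = - (X * a) := by
    have h' : t * a * a = b * b * t := by rw [mul_assoc, h]
    rw [hX, mul_sub, sub_mul, h', ← mul_assoc, ← mul_assoc]; abel
  have hQ : 0 ≤ star X * b * X := star_left_conjugate_nonneg hb X
  have hQ' : star X * X * a = - (star X * b * X) := by
    rw [mul_assoc (star X) b X, hbX]; simp [mul_assoc]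
  have hsP : star (star X * X * a) = star X * X * a := by
    rw [hQ', star_neg, (IsSelfAdjoint.of_nonneg hQ).star_eq]
  have hcomm : Commute (star X * X) a := by
    have h2 := hsP
    simp only [star_mul, star_star, hsa] at h2
    exact h2.symm
  have hP : 0 ≤ star X * X * a := Commute.mul_nonneg (star_mul_self_nonneg X) ha hcomm
  have hQ0 : star X * b * X = 0 := by
    apply le_antisymm _ hQ
    rw [hQ'] at hP
    exact neg_nonneg.mp hP
  have hP0 : star X * X * a = 0 := by rw [hQ', hQ0, neg_zero]
  have hXa : X * a = 0 := by
    rw [← CStarRing.star_mul_self_eq_zero_iff, star_mul, hsa, mul_assoc, ← mul_assoc (star X), hP0,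
      mul_zero]
  have hbX0 : b * X = 0 := by rw [hbX, hXa, neg_zero]
  have haX : a * star X = 0 := by
    have := congrArg star hXa
    simpa [hsa] using this
  have hXb : star X * b = 0 := by
    have := congrArg star hbX0
    simpa [hsb] using this
  have h3 : star X * X * star X = 0 := by
    calc star X * X * star X = star X * (t * a - b * t) * star X := by rw [← hX]
      _ = star X * t * (a * star X) - (star X * b) * t * star X := by
        simp only [mul_sub, sub_mul, mul_assoc]
      _ = 0 := by rw [haX, hXb]; simp
  have h4 : star X * X = 0 := by
    rw [← CStarRing.star_mul_self_eq_zero_iff, star_mul, star_star, ← mul_assoc, h3, zero_mul]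
  have h5 : X = 0 := CStarRing.star_mul_self_eq_zero_iff X |>.mp h4
  rw [hX] at h5
  exact sub_eq_zero.mp h5

theorem aux_isometry {H E : Type*}
    [NormedAddCommGroup H] [InnerProductSpace ℂ H] [CompleteSpace H]
    [NormedAddCommGroup E] [InnerProductSpace ℂ E] [CompleteSpace E]
    (L : H →L[ℂ] E) (hL : DenseRange L) (D : H →L[ℂ] H) (c : ℂ) (hc : c ≠ 0)
    (h : ∀ x, ‖c • D x‖ = ‖L x‖) :
    ∃ U : E →ₗᵢ[ℂ] H, (∀ x, U (L x) = c • D x) ∧ Set.range U = closure (Set.range D) := by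
  let f : H →ₗ[ℂ] H := (c • D : H →L[ℂ] H).toLinearMap
  have hn : ∃ C, ∀ x, ‖f x‖ ≤ C * ‖L.toLinearMap x‖ := ⟨1, fun x => by simpa [f] using (h x).le⟩
  let g : E →L[ℂ] H := f.extendOfNorm L.toLinearMap
  have hg : ∀ x, g (L x) = c • D x := fun x =>
    LinearMap.extendOfNorm_eq (f := f) (e := L.toLinearMap) hL hn x
  have hgn : ∀ e, ‖g e‖ = ‖e‖ := by
    intro e
    refine hL.induction (P := fun e => ‖g e‖ = ‖e‖) ?_
      (isClosed_eq (by fun_prop) (by fun_prop)) e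
    rintro _ ⟨x, rfl⟩
    rw [hg, h]
  let U : E →ₗᵢ[ℂ] H := ⟨g.toLinearMap, hgn⟩
  have hU : ∀ x, U (L x) = c • D x := hg
  refine ⟨U, hU, ?_⟩
  apply Set.Subset.antisymm
  · have h1 : Set.range U ⊆ closure (U '' Set.range L) := by
      rintro _ ⟨e, rfl⟩
      exact image_closure_subset_closure_image U.continuous ⟨e, hL e, rfl⟩
    refine h1.trans (closure_mono ?_)
    rintro _ ⟨_, ⟨x, rfl⟩, rfl⟩
    exact ⟨c • x, by rw [hU, map_smul]⟩
  · refine closure_minimal ?_ U.isometry.isClosedEmbedding.isClosed_range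
    rintro _ ⟨x, rfl⟩
    exact ⟨c⁻¹ • L x, by rw [map_smul, hU, smul_smul, inv_mul_cancel₀ hc, one_smul]⟩

theorem aux_norm_sq {H : Type*}
    [NormedAddCommGroup H] [InnerProductSpace ℂ H] [CompleteSpace H]
    (D T : H →L[ℂ] H) (hD : D.IsPositive)
    (h : D ∘L D = 1 - ContinuousLinearMap.adjoint T ∘L T) (x : H) :
    ⟪D x, D x⟫ = ⟪x, x⟫ - ⟪T x, T x⟫ := by
  have h1 : ⟪D x, D x⟫ = ⟪x, D (D x)⟫ := hD.isSymmetric x (D x)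
  have h2 : D (D x) = x - ContinuousLinearMap.adjoint T (T x) := by
    have := congrArg (fun F : H →L[ℂ] H => F x) h
    simpa using this
  rw [h1, h2, inner_sub_right, ContinuousLinearMap.adjoint_inner_right]

theorem aux_norm {H E : Type*}
    [NormedAddCommGroup H] [InnerProductSpace ℂ H]
    [NormedAddCommGroup E] [InnerProductSpace ℂ E] (c : ℂ) (hc : ‖c‖ ^ 2 * 2 = 1)
    (x : H) (y : E) (h : ⟪x, x⟫ = 2 * ⟪y, y⟫) : ‖c • x‖ = ‖y‖ := by
  rw [inner_self_eq_norm_sq_to_K, inner_self_eq_norm_sq_to_K] at h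
  have h' : ‖x‖ ^ 2 = 2 * ‖y‖ ^ 2 := by
    apply Complex.ofReal_injective
    push_cast
    exact h
  rw [norm_smul, ← sq_eq_sq₀ (by positivity) (by positivity), mul_pow, h']
  linear_combination ‖y‖ ^ 2 * hc

/-- Relation between the Štraus characteristic function and the
Sz.-Nagy–Foias characteristic function of the Cayley transform `T = (A - i)(A + i)⁻¹`
`= 1 - 2i (A + i)⁻¹`: with `D_T = √(1 - T*T)` and `D_{T*} = √(1 - TT*)` (positive square
roots, characterized here as positive operators whose square is the given operator),
there are surjective isometries `U : E → closure (Ran D_T)` and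
`Us : E_* → closure (Ran D_{T*})` such that for all `z` with `Im z > 0` and
`λ = (z - i)/(z + i)`, the Sz.-Nagy–Foias characteristic function
`Θ(λ) = (-T + λ D_{T*}(1 - λT*)⁻¹ D_T)|_{closure (Ran D_T)}` satisfies
`Θ(λ) = Us ∘ S(z) ∘ U*`, i.e. `Θ(λ)(U e) = Us (S z e)` for all `e ∈ E`. -/
theorem stmt12 {H E Es : Type*}
    [NormedAddCommGroup H] [InnerProductSpace ℂ H] [CompleteSpace H]
    [NormedAddCommGroup E] [InnerProductSpace ℂ E] [CompleteSpace E]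
    [NormedAddCommGroup Es] [InnerProductSpace ℂ Es] [CompleteSpace Es]
    (M : StrausSetting H E Es)
    (S : ℂ → E →L[ℂ] Es)
    (hS_norm : ∀ z : ℂ, 0 < z.im → ‖S z‖ ≤ 1)
    (hS : ∀ (z : ℂ), 0 < z.im → ∀ u : M.A.domain,
      S z (M.Γ u) = M.ΓsRs z (M.A u - z • (u : H)))
    (T DT DTs : H →L[ℂ] H)
    (hT : T = 1 - (2 * Complex.I) • M.R (-Complex.I))
    (hDT_pos : DT.IsPositive)
    (hDT_sq : DT ∘L DT = 1 - ContinuousLinearMap.adjoint T ∘L T)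
    (hDTs_pos : DTs.IsPositive)
    (hDTs_sq : DTs ∘L DTs = 1 - T ∘L ContinuousLinearMap.adjoint T) :
    ∃ (U : E →ₗᵢ[ℂ] H) (Us : Es →ₗᵢ[ℂ] H),
      Set.range U = closure (Set.range DT) ∧
      Set.range Us = closure (Set.range DTs) ∧
      ∀ (z : ℂ), 0 < z.im →
        ∀ Rl : H →L[ℂ] H,
          Rl ∘L ((1 : H →L[ℂ] H)
              - ((z - Complex.I) / (z + Complex.I)) • ContinuousLinearMap.adjoint T) = 1 →
          ((1 : H →L[ℂ] H)
              - ((z - Complex.I) / (z + Complex.I)) • ContinuousLinearMap.adjoint T) ∘L Rl = 1 →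
          ∀ e : E,
            (-T + ((z - Complex.I) / (z + Complex.I)) • (DTs ∘L Rl ∘L DT)) (U e)
              = Us (S z e) := by
  classical
  have hIm : (-Complex.I).im < 0 := by simp
  have hIp : 0 < (Complex.I).im := by simp
  -- the adjoint of the resolvent
  have hadj : ContinuousLinearMap.adjoint (M.R (-Complex.I)) = M.Rs Complex.I := by
    symm
    rw [ContinuousLinearMap.eq_adjoint_iff]
    intro k h
    have h1 := M.R_right _ hIm h
    have h2 := M.Rs_right _ hIp k
    have h3 := LinearPMap.adjoint_isFormalAdjoint M.dense_dom
      ⟨M.Rs Complex.I k, M.Rs_mem _ hIp k⟩ ⟨M.R (-Complex.I) h, M.R_mem _ hIm h⟩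
    conv_lhs => rw [← h1]
    conv_rhs => rw [← h2]
    simp only [inner_sub_left, inner_sub_right, inner_smul_left, inner_smul_right, h3,
      Complex.conj_I]
  have hTs : ContinuousLinearMap.adjoint T = 1 + (2 * Complex.I) • M.Rs Complex.I := by
    rw [hT, ← hadj, map_sub]
    have : ContinuousLinearMap.adjoint (1 : H →L[ℂ] H) = 1 := star_one _
    rw [this, map_smulₛₗ]
    simp [sub_eq_add_neg, Complex.conj_ofNat]
  have hTx : ∀ x, T x = x - (2 * Complex.I) • M.R (-Complex.I) x := by intro x; simp [hT]
  have hTsx : ∀ x, ContinuousLinearMap.adjoint T x = x + (2 * Complex.I) • M.Rs Complex.I x := by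
    intro x; simp [hTs]
  have hAR : ∀ h, M.A ⟨M.R (-Complex.I) h, M.R_mem _ hIm h⟩ = h - Complex.I • M.R (-Complex.I) h := by
    intro h
    have := M.R_right _ hIm h
    rw [neg_smul, sub_neg_eq_add] at this
    exact eq_sub_of_add_eq this
  have hARs : ∀ h, M.A.adjoint ⟨M.Rs Complex.I h, M.Rs_mem _ hIp h⟩
      = h + Complex.I • M.Rs Complex.I h := by
    intro h
    have := M.Rs_right _ hIp h
    rw [sub_eq_iff_eq_add] at this
    exact this
  have hI2 : Complex.I * Complex.I = -1 := Complex.I_mul_I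
  have hn1 : ∀ h, ⟪DT h, DT h⟫ = 2 * ⟪M.ΓR (-Complex.I) h, M.ΓR (-Complex.I) h⟫ := by
    intro h
    rw [aux_norm_sq DT T hDT_pos hDT_sq, M.ΓR_spec _ hIm]
    have h3 := M.lagrange ⟨M.R (-Complex.I) h, M.R_mem _ hIm h⟩ ⟨M.R (-Complex.I) h, M.R_mem _ hIm h⟩
    rw [hAR] at h3
    rw [hTx]
    simp only [inner_sub_left, inner_sub_right, inner_smul_left, inner_smul_right,
      Complex.conj_I, map_mul, Complex.conj_ofNat] at h3 ⊢
    generalize ⟪M.Γ ⟨M.R (-Complex.I) h, M.R_mem _ hIm h⟩, M.Γ ⟨M.R (-Complex.I) h, M.R_mem _ hIm h⟩⟫ = G at *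
    linear_combination (-2 * Complex.I) * h3 - 2 * G * hI2
  have hn2 : ∀ h, ⟪DTs h, DTs h⟫ = 2 * ⟪M.ΓsRs Complex.I h, M.ΓsRs Complex.I h⟫ := by
    intro h
    rw [aux_norm_sq DTs (ContinuousLinearMap.adjoint T) hDTs_pos (by simpa using hDTs_sq),
      M.ΓsRs_spec _ hIp]
    have h3 := M.lagrange_star ⟨M.Rs Complex.I h, M.Rs_mem _ hIp h⟩ ⟨M.Rs Complex.I h, M.Rs_mem _ hIp h⟩
    rw [hARs] at h3
    rw [hTsx]
    simp only [inner_add_left, inner_add_right, inner_smul_left, inner_smul_right,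
      Complex.conj_I, map_mul, Complex.conj_ofNat] at h3 ⊢
    generalize ⟪M.Γs ⟨M.Rs Complex.I h, M.Rs_mem _ hIp h⟩, M.Γs ⟨M.Rs Complex.I h, M.Rs_mem _ hIp h⟩⟫ = G at *
    linear_combination (2 * Complex.I) * h3 - 2 * G * hI2
  have hΓR : ∀ u : M.A.domain, M.ΓR (-Complex.I) (M.A u - (-Complex.I) • (u : H)) = M.Γ u := by
    intro u
    rw [M.ΓR_spec _ hIm]
    congr 1
    exact Subtype.ext (M.R_left _ hIm u)
  have hΓsRs : ∀ u : M.A.adjoint.domain,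
      M.ΓsRs Complex.I (M.A.adjoint u - Complex.I • (u : H)) = M.Γs u := by
    intro u
    rw [M.ΓsRs_spec _ hIp]
    congr 1
    exact Subtype.ext (M.Rs_left _ hIp u)
  have hd1 : DenseRange (M.ΓR (-Complex.I)) := by
    refine M.Γ_dense.mono ?_
    rintro _ ⟨u, rfl⟩
    exact ⟨_, hΓR u⟩
  have hd2 : DenseRange (M.ΓsRs Complex.I) := by
    refine M.Γs_dense.mono ?_
    rintro _ ⟨u, rfl⟩
    exact ⟨_, hΓsRs u⟩
  obtain ⟨c, hc⟩ : ∃ c : ℂ, ‖c‖ ^ 2 * 2 = 1 := by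
    refine ⟨(((Real.sqrt 2)⁻¹ : ℝ) : ℂ), ?_⟩
    rw [Complex.norm_real, Real.norm_eq_abs, sq_abs, inv_pow, Real.sq_sqrt (by norm_num)]
    norm_num
  have hc0 : c ≠ 0 := by
    rintro rfl
    simp at hc
  obtain ⟨U, hU, hUr⟩ := aux_isometry (M.ΓR (-Complex.I)) hd1 DT c hc0
    (fun x => aux_norm c hc _ _ (hn1 x))
  obtain ⟨Us, hUs, hUsr⟩ := aux_isometry (M.ΓsRs Complex.I) hd2 DTs (-c) (neg_ne_zero.mpr hc0)
    (fun x => aux_norm (-c) (by rw [norm_neg]; exact hc) _ _ (hn2 x))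
  have hint : T * DT = DTs * T := by
    apply aux_intertwine
    · exact (ContinuousLinearMap.nonneg_iff_isPositive _).mpr hDT_pos
    · exact (ContinuousLinearMap.nonneg_iff_isPositive _).mpr hDTs_pos
    · have e1 : DT * DT = 1 - ContinuousLinearMap.adjoint T * T := hDT_sq
      have e2 : DTs * DTs = 1 - T * ContinuousLinearMap.adjoint T := hDTs_sq
      rw [e1, e2, mul_sub, sub_mul, mul_one, one_mul, mul_assoc]
  refine ⟨U, Us, hUr, hUsr, ?_⟩
  intro z hz Rl hRl1 _ e
  refine hd1.induction (P := fun e =>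
    (-T + ((z - Complex.I) / (z + Complex.I)) • (DTs ∘L Rl ∘L DT)) (U e) = Us (S z e)) ?_
    (isClosed_eq (by fun_prop) (by fun_prop)) e
  rintro _ ⟨h, rfl⟩
  have hzI : z + Complex.I ≠ 0 := by
    intro h0
    have := congrArg Complex.im h0
    simp at this
    linarith
  obtain ⟨l, hl⟩ : ∃ l, l = (z - Complex.I) / (z + Complex.I) := ⟨_, rfl⟩
  rw [← hl] at hRl1 ⊢
  have hlz : l * (z + Complex.I) = z - Complex.I := by rw [hl]; field_simp
  have hRl : ∀ x, Rl (x - l • ContinuousLinearMap.adjoint T x) = x := by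
    intro x
    have := congrArg (fun F : H →L[ℂ] H => F x) hRl1
    simpa using this
  -- names
  obtain ⟨u, hu⟩ : ∃ u : M.A.domain, u = ⟨M.R (-Complex.I) h, M.R_mem _ hIm h⟩ := ⟨_, rfl⟩
  have huv : (u : H) = M.R (-Complex.I) h := by rw [hu]
  have hAu : M.A u = h - Complex.I • (u : H) := by rw [hu]; exact hAR h
  obtain ⟨g, hg⟩ : ∃ g, g = M.A u - z • (u : H) := ⟨_, rfl⟩
  obtain ⟨w, hw⟩ : ∃ w : M.A.adjoint.domain, w = ⟨M.Rs z g, M.Rs_mem _ hz g⟩ := ⟨_, rfl⟩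
  have hAw : M.A.adjoint w - z • (w : H) = g := by rw [hw]; exact M.Rs_right z hz g
  obtain ⟨k, hk⟩ : ∃ k, k = M.A.adjoint w - Complex.I • (w : H) := ⟨_, rfl⟩
  have hkw : M.Rs Complex.I k = w := by rw [hk]; exact M.Rs_left _ hIp w
  have hSz : S z (M.ΓR (-Complex.I) h) = M.ΓsRs Complex.I k := by
    rw [M.ΓR_spec _ hIm, ← hu, hS z hz, ← hg, M.ΓsRs_spec _ hz, ← hw, hk, hΓsRs]
  rw [hSz, hU, hUs]
  have hTu : T h = h - (2 * Complex.I) • (u : H) := by rw [hTx, huv]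
  have hTk : ContinuousLinearMap.adjoint T k = k + (2 * Complex.I) • (w : H) := by rw [hTsx, hkw]
  have hDD : DT (DT h) = h - ContinuousLinearMap.adjoint T (T h) := by
    have := congrArg (fun F : H →L[ℂ] H => F h) hDT_sq
    simpa using this
  have hrel : k - l • ContinuousLinearMap.adjoint T k = T h - l • h := by
    have hk' : k = h - (z + Complex.I) • (u : H) + (z - Complex.I) • (w : H) := by
      have : M.A.adjoint w = g + z • (w : H) := by rw [← hAw]; abel
      rw [hk, this, hg, hAu]
      module
    have hl' : (1 - l) * (z + Complex.I) = 2 * Complex.I := by linear_combination -hlz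
    rw [hTk, hTu]
    have e1 : k - l • (k + (2 * Complex.I) • (w : H)) =
        (1 - l) • h - ((1 - l) * (z + Complex.I)) • (u : H)
        + ((1 - l) * (z - Complex.I) - l * (2 * Complex.I)) • (w : H) := by
      rw [hk']
      module
    have e2 : (1 - l) * (z - Complex.I) - l * (2 * Complex.I) = 0 := by linear_combination -hlz
    rw [e1, e2, hl']
    module
  have hkR : k = Rl (T h - l • h) := by rw [← hrel, hRl]
  have hTh : l • Rl (DT (DT h)) = T h - k := by
    rw [hkR, hDD]
    conv_rhs => enter [1]; rw [← hRl (T h)]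
    rw [← map_sub, ← map_smul]
    congr 1
    module
  have hint' : T (DT h) = DTs (T h) := congrArg (fun F : H →L[ℂ] H => F h) hint
  have final : (-T + l • (DTs ∘L Rl ∘L DT)) (DT h) = - DTs k := by
    simp only [add_apply, neg_apply,
      smul_apply, ContinuousLinearMap.comp_apply]
    rw [← map_smul, hTh, hint', map_sub]
    abel
  rw [map_smul, final, smul_neg, neg_smul]

end
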